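/- Let R be a unital ℂ-algebra, 0<q<1, r ≥ 0, λ = q − q⁻¹, with elements A,B,B',E,F,K,K' satisfying the defining relations of O(S²_{qr}) ⋊ U_q(su₂): KK' = K'K = 1, KE = qEK, FK = qKF, EF − FE = λ⁻¹(K² − K'²), AB = q⁻²BA, AB' = q²B'A, B'B = A − A² + r, BB' = q²A − q⁴A² + r, KA = AK, EA = AE + q^{−1/2}B'K, FA = AF − q^{−3/2}BK, KB = q⁻¹BK, EB = qBE − q^{1/2}(1+q²)AK + q^{1/2}K, FB = qBF, KB' = qB'K, EB' = q⁻¹B'E, FB' = q⁻¹B'F + q^{−1/2}(1+q²)AK − q^{−1/2}K. Define X := q^{3/2}λ·F·K'·A + q·B, X' := q^{3/2}λ·A·K'·E + q·B', Y := q·K'²·A. Then YX = q²·X·Y, Y·X' = q⁻²·X'·Y, and X'·X − q²·X·X' = (1−q²)·(Y² + r). -/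

import Mathlib

set_option linter.unusedSimpArgs false

theorem mulAux {R : Type*} [Ring R] {a b c : R} (h : a * b = c) (x : R) :
    a * (b * x) = c * x := by rw [← mul_assoc, h]

theorem stmtAux {R : Type*} [Ring R] [Algebra ℂ R]
    (s r l : ℂ) (hs : s ≠ 0) (hl0 : s ^ 4 - 1 ≠ 0) (hl : l = (s ^ 4 - 1) / s ^ 2)
    (A B B' E F K K' : R)
    (hKK' : K * K' = 1) (hK'K : K' * K = 1)
    (hKE : K * E = (s ^ 2) • (E * K)) (hFK : F * K = (s ^ 2) • (K * F))
    (hEF : E * F - F * E = (l⁻¹) • (K * K - K' * K'))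
    (hAB : A * B = ((s ^ 4)⁻¹) • (B * A))
    (hAB' : A * B' = (s ^ 4) • (B' * A))
    (hB'B : B' * B = A - A * A + r • (1 : R))
    (hBB' : B * B' = (s ^ 4) • A - (s ^ 8) • (A * A) + r • (1 : R))
    (hKA : K * A = A * K)
    (hEA : E * A = A * E + (s⁻¹) • (B' * K))
    (hFA : F * A = A * F - ((s ^ 3)⁻¹) • (B * K))
    (hKB : K * B = ((s ^ 2)⁻¹) • (B * K))
    (hEB : E * B = (s ^ 2) • (B * E) - (s * (1 + s ^ 4)) • (A * K) + s • K)
    (hFB : F * B = (s ^ 2) • (B * F))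
    (hKB' : K * B' = (s ^ 2) • (B' * K))
    (hEB' : E * B' = ((s ^ 2)⁻¹) • (B' * E))
    (hFB' : F * B' = ((s ^ 2)⁻¹) • (B' * F) + (s⁻¹ * (1 + s ^ 4)) • (A * K) - (s⁻¹) • K)
    (X X' Y : R)
    (hX : X = (s ^ 3 * l) • (F * K' * A) + (s ^ 2) • B)
    (hX' : X' = (s ^ 3 * l) • (A * K' * E) + (s ^ 2) • B')
    (hY : Y = (s ^ 2) • (K' * K' * A)) :
    Y * X = (s ^ 4) • (X * Y) ∧
    Y * X' = ((s ^ 4)⁻¹) • (X' * Y) ∧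
    X' * X - (s ^ 4) • (X * X') = (1 - s ^ 4) • (Y * Y + r • (1 : R)) := by
  have conj : ∀ (Z : R) (t u : ℂ), t * u = 1 → K * Z = t • (Z * K) → K' * Z = u • (Z * K') := by
    intro Z t u htu h
    have h1 : K' * (K * Z) * K' = t • (K' * Z) := by
      rw [h, mul_smul_comm, smul_mul_assoc, mul_assoc, mul_assoc, hKK', mul_one]
    rw [← mul_assoc, hK'K, one_mul] at h1
    rw [h1, smul_smul, mul_comm u t, htu, one_smul]
  have hKF : K * F = ((s ^ 2)⁻¹) • (F * K) := by
    rw [hFK, smul_smul, inv_mul_cancel₀ (pow_ne_zero _ hs), one_smul]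
  have kA : K' * A = A * K' := by
    have := conj A 1 1 (by simp) (by simpa using hKA)
    simpa using this
  have kB := conj B _ (s ^ 2) (by field_simp) hKB
  have kB' := conj B' _ ((s ^ 2)⁻¹) (by field_simp) hKB'
  have kE := conj E _ ((s ^ 2)⁻¹) (by field_simp) hKE
  have kF := conj F _ (s ^ 2) (by field_simp) hKF
  have hEF' : E * F = F * E + (l⁻¹) • (K * K - K' * K') := by rw [← hEF]; abel
  clear hFK hEF conj
  have a1 := mulAux hKK'
  have a2 := mulAux hK'K
  have a3 := mulAux hKE
  have a4 := mulAux hKF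
  have a5 := mulAux hEF'
  have a6 := mulAux hAB
  have a7 := mulAux hAB'
  have a8 := mulAux hB'B
  have a9 := mulAux hBB'
  have a10 := mulAux hKA
  have a11 := mulAux hEA
  have a12 := mulAux hFA
  have a13 := mulAux hKB
  have a14 := mulAux hEB
  have a15 := mulAux hFB
  have a16 := mulAux hKB'
  have a17 := mulAux hEB'
  have a18 := mulAux hFB'
  have a19 := mulAux kA
  have a20 := mulAux kB
  have a21 := mulAux kB'
  have a22 := mulAux kE
  have a23 := mulAux kF
  subst hX hX' hY
  refine ⟨?_, ?_, ?_⟩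
  · simp only [mul_assoc, mul_add, add_mul, mul_sub, sub_mul, smul_mul_assoc, mul_smul_comm,
      one_mul, mul_one, hKK', hK'K, hKE, hKF, hEF', hAB, hAB', hB'B, hBB', hKA, hEA, hFA, hKB, hEB,
      hFB, hKB', hEB', hFB', kA, kB, kB', kE, kF, a1, a2, a3, a4, a5, a6, a7, a8, a9, a10, a11, a12,
      a13, a14, a15, a16, a17, a18, a19, a20, a21, a22, a23]
    match_scalars <;> rw [hl] <;> field_simp <;> ring
  · simp only [mul_assoc, mul_add, add_mul, mul_sub, sub_mul, smul_mul_assoc, mul_smul_comm,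
      one_mul, mul_one, hKK', hK'K, hKE, hKF, hEF', hAB, hAB', hB'B, hBB', hKA, hEA, hFA, hKB, hEB,
      hFB, hKB', hEB', hFB', kA, kB, kB', kE, kF, a1, a2, a3, a4, a5, a6, a7, a8, a9, a10, a11, a12,
      a13, a14, a15, a16, a17, a18, a19, a20, a21, a22, a23]
    match_scalars <;> rw [hl] <;> field_simp <;> ring
  · simp only [mul_assoc, mul_add, add_mul, mul_sub, sub_mul, smul_mul_assoc, mul_smul_comm,
      one_mul, mul_one, hKK', hK'K, hKE, hKF, hEF', hAB, hAB', hB'B, hBB', hKA, hEA, hFA, hKB, hEB,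
      hFB, hKB', hEB', hFB', kA, kB, kB', kE, kF, a1, a2, a3, a4, a5, a6, a7, a8, a9, a10, a11, a12,
      a13, a14, a15, a16, a17, a18, a19, a20, a21, a22, a23]
    match_scalars <;> rw [hl] <;> field_simp <;> ring

theorem stmt_16 {R : Type*} [Ring R] [Algebra ℂ R]
    (q r : ℝ) (hq : 0 < q) (hq1 : q < 1) (hr : 0 ≤ r)
    (lam : ℝ) (hlam : lam = q - q⁻¹)
    (A B B' E F K K' : R)
    (hKK' : K * K' = 1) (hK'K : K' * K = 1)
    (hKE : K * E = (q : ℂ) • (E * K)) (hFK : F * K = (q : ℂ) • (K * F))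
    (hEF : E * F - F * E = ((lam⁻¹ : ℝ) : ℂ) • (K * K - K' * K'))
    (hAB : A * B = (((q : ℝ) ^ 2)⁻¹ : ℂ) • (B * A))
    (hAB' : A * B' = ((q : ℂ) ^ 2) • (B' * A))
    (hB'B : B' * B = A - A * A + (r : ℂ) • (1 : R))
    (hBB' : B * B' = ((q : ℂ) ^ 2) • A - ((q : ℂ) ^ 4) • (A * A) + (r : ℂ) • (1 : R))
    (hKA : K * A = A * K)
    (hEA : E * A = A * E + ((q ^ (-(1 : ℝ)/2) : ℝ) : ℂ) • (B' * K))
    (hFA : F * A = A * F - ((q ^ (-(3 : ℝ)/2) : ℝ) : ℂ) • (B * K))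
    (hKB : K * B = ((q⁻¹ : ℝ) : ℂ) • (B * K))
    (hEB : E * B = (q : ℂ) • (B * E)
        - ((q ^ ((1 : ℝ)/2) * (1 + q ^ 2) : ℝ) : ℂ) • (A * K)
        + ((q ^ ((1 : ℝ)/2) : ℝ) : ℂ) • K)
    (hFB : F * B = (q : ℂ) • (B * F))
    (hKB' : K * B' = (q : ℂ) • (B' * K))
    (hEB' : E * B' = ((q⁻¹ : ℝ) : ℂ) • (B' * E))
    (hFB' : F * B' = ((q⁻¹ : ℝ) : ℂ) • (B' * F)
        + ((q ^ (-(1 : ℝ)/2) * (1 + q ^ 2) : ℝ) : ℂ) • (A * K)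
        - ((q ^ (-(1 : ℝ)/2) : ℝ) : ℂ) • K)
    (X X' Y : R)
    (hX : X = ((q ^ ((3 : ℝ)/2) * lam : ℝ) : ℂ) • (F * K' * A) + (q : ℂ) • B)
    (hX' : X' = ((q ^ ((3 : ℝ)/2) * lam : ℝ) : ℂ) • (A * K' * E) + (q : ℂ) • B')
    (hY : Y = (q : ℂ) • (K' * K' * A)) :
    Y * X = ((q : ℂ) ^ 2) • (X * Y) ∧
    Y * X' = (((q : ℝ) ^ 2)⁻¹ : ℂ) • (X' * Y) ∧
    X' * X - ((q : ℂ) ^ 2) • (X * X')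
      = ((1 - q ^ 2 : ℝ) : ℂ) • (Y * Y + (r : ℂ) • (1 : R)) := by
  have hs0 : (0:ℝ) < q ^ ((1:ℝ)/2) := Real.rpow_pos_of_pos hq _
  obtain ⟨s, hs⟩ : ∃ s : ℝ, s = q ^ ((1:ℝ)/2) := ⟨_, rfl⟩
  have e2 : q = s ^ 2 := by
    rw [hs, ← Real.rpow_natCast, ← Real.rpow_mul hq.le]; norm_num
  have e3 : q ^ ((3:ℝ)/2) = s ^ 3 := by
    rw [hs, ← Real.rpow_natCast, ← Real.rpow_mul hq.le]; norm_num
  have e1' : q ^ (-(1:ℝ)/2) = s⁻¹ := by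
    rw [hs, ← Real.rpow_neg hq.le]; norm_num
  have e3' : q ^ (-(3:ℝ)/2) = (s ^ 3)⁻¹ := by
    rw [← e3, ← Real.rpow_neg hq.le]; norm_num
  rw [← hs] at hs0
  rw [e3] at hX hX'
  rw [e3'] at hFA
  rw [e1'] at hEA
  simp only [e1'] at hFB'
  simp only [← hs] at hEB
  clear e3 e3' e1' hs
  subst e2
  have hsC : (s : ℂ) ≠ 0 := by exact_mod_cast hs0.ne'
  have h4 : s ^ 4 < 1 := by nlinarith
  have h4C : (s : ℂ) ^ 4 - 1 ≠ 0 := by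
    have : s ^ 4 - 1 ≠ 0 := by linarith
    exact_mod_cast this
  have hlC : (lam : ℂ) = ((s : ℂ) ^ 4 - 1) / (s : ℂ) ^ 2 := by
    rw [hlam]; push_cast; field_simp
  push_cast at *
  simp only [← pow_mul] at *
  norm_num only at *
  exact stmtAux (s : ℂ) r lam hsC h4C hlC A B B' E F K K' hKK' hK'K hKE hFK hEF hAB hAB' hB'B hBB'
    hKA hEA hFA hKB hEB hFB hKB' hEB' hFB' X X' Y hX hX' hY
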